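/- arXiv:1110.0425 — 2 statements merged into one kernel-verified Lean document; each statement's English description precedes it below -/
import Mathlib

section
/- Binary example: let the source be Bernoulli(p) on {0,1} and the channel be a binary symmetric channel with crossover probability ε (i.e., P_{Y|X}(y|x) = 1−ε if y = x and ε otherwise). Suppose 0 ≤ ε ≤ d ≤ p ≤ 1/2 and d < 1/2. Let q = (p−d)/(1−2d), and let P_{SXYŜ} be the joint law of (S, X, Y, Ŝ) where X ∼ Bernoulli(q), S = X ⊕ Z₁ with Z₁ ∼ Bernoulli(d) independent of X, Y = X ⊕ Z₂ with Z₂ ∼ Bernoulli(ε) independent of (X, Z₁), and Ŝ = X. Then P_{SXYŜ} is consistent with the source and channel, satisfies ℙ[S ≠ Ŝ] = ℙ[S ≠ X] = d, and is achievable with a noncausal encoder. -/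
open scoped BigOperators

noncomputable section

/-- `p` is a probability mass function on the finite type `α`. -/
def IsPMF {α : Type*} [Fintype α] (p : α → ℝ) : Prop :=
  (∀ a, 0 ≤ p a) ∧ (∑ a, p a) = 1

/-- Probability of the event `E` under the pmf `P`. -/
def prob {Ω : Type*} [Fintype Ω] (P : Ω → ℝ) (E : Set Ω) : ℝ :=
  ∑ ω, E.indicator P ω

/-- Probability that the random variable `f` takes the value `a`, under `P`. -/
def margProb {Ω A : Type*} [Fintype Ω] (P : Ω → ℝ) (f : Ω → A) (a : A) : ℝ :=
  prob P {ω | f ω = a}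

/-- Mutual information `I(f;g)` (base-2 logarithms) of random variables `f`, `g`
defined on a finite probability space with pmf `P`. -/
def mutInfo {Ω A B : Type*} [Fintype Ω] [Fintype A] [Fintype B]
    (P : Ω → ℝ) (f : Ω → A) (g : Ω → B) : ℝ :=
  ∑ a : A, ∑ b : B,
    margProb P (fun ω => (f ω, g ω)) (a, b) *
      Real.logb 2 (margProb P (fun ω => (f ω, g ω)) (a, b) /
        (margProb P f a * margProb P g b))

/-- Conditional mutual information `I(f;g|h)` (base-2 logarithms). -/
def condMutInfo {Ω A B C : Type*} [Fintype Ω] [Fintype A] [Fintype B] [Fintype C]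
    (P : Ω → ℝ) (f : Ω → A) (g : Ω → B) (h : Ω → C) : ℝ :=
  ∑ a : A, ∑ b : B, ∑ c : C,
    margProb P (fun ω => (f ω, g ω, h ω)) (a, b, c) *
      Real.logb 2
        ((margProb P (fun ω => (f ω, g ω, h ω)) (a, b, c) * margProb P h c) /
          (margProb P (fun ω => (f ω, h ω)) (a, c) *
            margProb P (fun ω => (g ω, h ω)) (b, c)))

/-- Total variation distance between two pmfs: half the ℓ¹ distance. -/
def tvDist {α : Type*} [Fintype α] (P Q : α → ℝ) : ℝ :=
  (∑ a, |P a - Q a|) / 2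

/-- Empirical distribution of the sequence `w`. -/
def empDist {n : ℕ} {α : Type*} (w : Fin n → α) (a : α) : ℝ :=
  (∑ i : Fin n, ({i | w i = a} : Set (Fin n)).indicator (fun _ => (1 : ℝ)) i) / n

/-- Causality classes for the encoder. -/
inductive EncoderClass | noncausal | causal | strictlyCausal

/-- The encoder `f` respects the causality class `c`:
a noncausal encoder has `Xᵢ = fᵢ(Sⁿ)`, a causal encoder has `Xᵢ = fᵢ(Sⁱ)`
(it only depends on `S₁,…,Sᵢ`), and a strictly causal encoder has
`Xᵢ = fᵢ(Sⁱ⁻¹)` (it only depends on `S₁,…,Sᵢ₋₁`). -/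
def EncOK {n : ℕ} {S X : Type*} : EncoderClass → (Fin n → (Fin n → S) → X) → Prop
  | .noncausal, _ => True
  | .causal, f => ∀ (i : Fin n) (s s' : Fin n → S),
      (∀ j, j ≤ i → s j = s' j) → f i s = f i s'
  | .strictlyCausal, f => ∀ (i : Fin n) (s s' : Fin n → S),
      (∀ j, j < i → s j = s' j) → f i s = f i s'

/-- The joint pmf of `(Sⁿ, Yⁿ)` induced by the i.i.d. source `PS`, the memoryless
channel `PYX` and the (deterministic) encoder `f`. -/
def inducedP {S X Y : Type*} {n : ℕ}
    (PS : S → ℝ) (PYX : X → Y → ℝ) (f : Fin n → (Fin n → S) → X) :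
    (Fin n → S) × (Fin n → Y) → ℝ :=
  fun sy => (∏ i, PS (sy.1 i)) * ∏ i, PYX (f i sy.1) (sy.2 i)

/-- `P` (a pmf on `S × X × Y × Z`) is achievable for the source `PS` and channel `PYX`
with an encoder of causality class `c`: for every `ε > 0` there are a block length
`n` and a block-`n` code such that with probability at least `1 - ε` the empirical
distribution of `(Sⁿ, Xⁿ, Yⁿ, Ŝⁿ)` is within total variation `ε` of `P`. -/
def Achievable {S X Y Z : Type*} [Fintype S] [Fintype X] [Fintype Y] [Fintype Z]
    (PS : S → ℝ) (PYX : X → Y → ℝ) (c : EncoderClass)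
    (P : S × X × Y × Z → ℝ) : Prop :=
  ∀ ε : ℝ, 0 < ε →
    ∃ n : ℕ, 0 < n ∧
      ∃ (f : Fin n → (Fin n → S) → X) (g : Fin n → (Fin n → Y) → Z),
        EncOK c f ∧
        prob (inducedP PS PYX f)
          {sy | ε <
            tvDist (empDist (fun i => (sy.1 i, f i sy.1, sy.2 i, g i sy.2))) P} < ε


/-! ### Finite probability spaces and the weak law of large numbers -/

theorem prob_mono {Ω : Type*} [Fintype Ω] {P : Ω → ℝ} (hP : ∀ ω, 0 ≤ P ω) {E F : Set Ω}
    (h : ∀ ω, P ω ≠ 0 → ω ∈ E → ω ∈ F) : prob P E ≤ prob P F := by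
  classical
  refine Finset.sum_le_sum fun ω _ => ?_
  by_cases h0 : P ω = 0
  · simp [Set.indicator_apply, h0]
  · by_cases hE : ω ∈ E
    · simp [hE, h ω h0 hE]
    · rw [Set.indicator_of_notMem hE]
      exact Set.indicator_nonneg (fun _ _ => hP _) _

theorem prob_nonneg {Ω : Type*} [Fintype Ω] {P : Ω → ℝ} (hP : ∀ ω, 0 ≤ P ω) (E : Set Ω) :
    0 ≤ prob P E :=
  Finset.sum_nonneg fun _ _ => Set.indicator_nonneg (fun _ _ => hP _) _

theorem prob_union_le {Ω : Type*} [Fintype Ω] {P : Ω → ℝ} (hP : ∀ ω, 0 ≤ P ω) (E F : Set Ω) :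
    prob P (E ∪ F) ≤ prob P E + prob P F := by
  classical
  unfold prob
  rw [← Finset.sum_add_distrib]
  refine Finset.sum_le_sum fun ω _ => ?_
  have := hP ω
  by_cases hE : ω ∈ E <;> by_cases hF : ω ∈ F <;> simp [hE, hF, this]

theorem prob_iUnion_le {Ω ι : Type*} [Fintype Ω] [Fintype ι] {P : Ω → ℝ} (hP : ∀ ω, 0 ≤ P ω)
    (E : ι → Set Ω) : prob P (⋃ i, E i) ≤ ∑ i, prob P (E i) := by
  classical
  unfold prob
  rw [Finset.sum_comm]
  refine Finset.sum_le_sum fun ω _ => ?_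
  by_cases h : ω ∈ ⋃ i, E i
  · obtain ⟨i, hi⟩ := Set.mem_iUnion.1 h
    rw [Set.indicator_of_mem h, ← Set.indicator_of_mem hi P]
    exact Finset.single_le_sum (f := fun j => (E j).indicator P ω)
      (fun j _ => Set.indicator_nonneg (fun _ _ => hP _) _) (Finset.mem_univ i)
  · rw [Set.indicator_of_notMem h]
    exact Finset.sum_nonneg fun j _ => Set.indicator_nonneg (fun _ _ => hP _) _

/-- The law of `n` independent samples from `P`. -/
def iidPMF {α : Type*} (P : α → ℝ) (n : ℕ) (w : Fin n → α) : ℝ := ∏ i, P (w i)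

theorem iidPMF_nonneg {α : Type*} [Fintype α] {P : α → ℝ} (hP : IsPMF P) {n : ℕ}
    (w : Fin n → α) : 0 ≤ iidPMF P n w :=
  Finset.prod_nonneg fun _ _ => hP.1 _

theorem isPMF_pi {ι α : Type*} [Fintype ι] [DecidableEq ι] [Fintype α] {P : ι → α → ℝ}
    (hP : ∀ i, IsPMF (P i)) : IsPMF fun w : ι → α => ∏ i, P i (w i) := by
  refine ⟨fun w => Finset.prod_nonneg fun i _ => (hP i).1 _, ?_⟩
  rw [← Fintype.prod_sum]
  exact Finset.prod_eq_one fun i _ => (hP i).2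

theorem isPMF_iidPMF {α : Type*} [Fintype α] {P : α → ℝ} (hP : IsPMF P) (n : ℕ) :
    IsPMF (iidPMF P n) :=
  isPMF_pi fun _ => hP

theorem sum_iidPMF_mul_prod {α : Type*} [Fintype α] (P : α → ℝ) {n : ℕ} (F : Fin n → α → ℝ) :
    ∑ w, iidPMF P n w * ∏ i, F i (w i) = ∏ i, ∑ a, P a * F i a := by
  rw [Fintype.prod_sum]
  exact Finset.sum_congr rfl fun w _ => Finset.prod_mul_distrib.symm

theorem sum_iidPMF_mul_mul {α : Type*} [Fintype α] {P : α → ℝ} (hP : IsPMF P) {n : ℕ}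
    {i j : Fin n} (hij : i ≠ j) (φ ψ : α → ℝ) :
    ∑ w, iidPMF P n w * (φ (w i) * ψ (w j)) = (∑ a, P a * φ a) * ∑ a, P a * ψ a := by
  have h := sum_iidPMF_mul_prod P (n := n)
    fun k a => (if k = i then φ a else 1) * (if k = j then ψ a else 1)
  have h1 : ∀ k, ∑ a, P a * ((if k = i then φ a else 1) * (if k = j then ψ a else 1))
      = (if k = i then ∑ a, P a * φ a else 1) * (if k = j then ∑ a, P a * ψ a else 1) := by
    intro k
    by_cases hi : k = i
    · have hj : k ≠ j := hi ▸ hij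
      simp [hi, hij]
    · by_cases hj : k = j
      · simp [hj, hij.symm]
      · simp [hi, hj, hP.2]
  simp only [h1, Finset.prod_mul_distrib, Finset.prod_ite_eq', Finset.mem_univ, if_true] at h
  exact h

theorem sum_iidPMF_mul {α : Type*} [Fintype α] {P : α → ℝ} (hP : IsPMF P) {n : ℕ}
    (i : Fin n) (φ : α → ℝ) :
    ∑ w, iidPMF P n w * φ (w i) = ∑ a, P a * φ a := by
  have h := sum_iidPMF_mul_prod P (n := n) fun k a => if k = i then φ a else 1
  have h1 : ∀ k, ∑ a, P a * (if k = i then φ a else 1) = if k = i then ∑ a, P a * φ a else 1 := by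
    intro k
    by_cases hi : k = i <;> simp [hi, hP.2]
  simpa only [h1, Finset.prod_ite_eq', Finset.mem_univ, if_true] using h

theorem sum_iidPMF_mul_sq {α : Type*} [Fintype α] {P : α → ℝ} (hP : IsPMF P) (n : ℕ)
    {ψ : α → ℝ} (hψ : ∑ a, P a * ψ a = 0) :
    ∑ w, iidPMF P n w * (∑ i, ψ (w i)) ^ 2 = n * ∑ a, P a * ψ a ^ 2 := by
  have h : ∀ i j : Fin n, ∑ w, iidPMF P n w * (ψ (w i) * ψ (w j))
      = if i = j then ∑ a, P a * ψ a ^ 2 else 0 := by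
    intro i j
    by_cases hij : i = j
    · subst hij
      simpa [sq] using sum_iidPMF_mul hP i fun a => ψ a * ψ a
    · rw [sum_iidPMF_mul_mul hP hij, hψ]
      simp [hij]
  calc ∑ w, iidPMF P n w * (∑ i, ψ (w i)) ^ 2
      = ∑ w, ∑ i, ∑ j, iidPMF P n w * (ψ (w i) * ψ (w j)) := by
        refine Finset.sum_congr rfl fun w _ => ?_
        rw [sq, Finset.sum_mul_sum, Finset.mul_sum]
        exact Finset.sum_congr rfl fun i _ => Finset.mul_sum _ _ _
    _ = ∑ i, ∑ j, ∑ w, iidPMF P n w * (ψ (w i) * ψ (w j)) := by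
        rw [Finset.sum_comm]
        exact Finset.sum_congr rfl fun i _ => Finset.sum_comm
    _ = n * ∑ a, P a * ψ a ^ 2 := by simp [h]

/-- Chebyshev's inequality for sample means. -/
theorem prob_iidPMF_deviation_le {α : Type*} [Fintype α] {P : α → ℝ} (hP : IsPMF P)
    (φ : α → ℝ) {δ : ℝ} (hδ : 0 < δ) {n : ℕ} (hn : 0 < n) :
    prob (iidPMF P n) {w | δ * n < |∑ i, φ (w i) - n * ∑ a, P a * φ a|}
      ≤ (∑ a, P a * (φ a - ∑ b, P b * φ b) ^ 2) / δ ^ 2 / n := by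
  classical
  set μ := ∑ a, P a * φ a with hμ
  have hn' : (0 : ℝ) < n := by exact_mod_cast hn
  have h0 : ∑ a, P a * (φ a - μ) = 0 := by
    simp only [mul_sub, Finset.sum_sub_distrib, ← Finset.sum_mul, hP.2, ← hμ]
    ring
  have h2 := sum_iidPMF_mul_sq hP n h0
  rw [div_div, le_div_iff₀ (by positivity)]
  have h3 : prob (iidPMF P n) {w | δ * n < |∑ i, φ (w i) - n * μ|} * (δ * n) ^ 2
      ≤ n * ∑ a, P a * (φ a - μ) ^ 2 := by
    rw [← h2, prob, Finset.sum_mul]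
    refine Finset.sum_le_sum fun w _ => ?_
    have hw := iidPMF_nonneg hP w
    by_cases hE : w ∈ {w : Fin n → α | δ * n < |∑ i, φ (w i) - n * μ|}
    · rw [Set.indicator_of_mem hE]
      refine mul_le_mul_of_nonneg_left ?_ hw
      have : ∑ i, (φ (w i) - μ) = ∑ i, φ (w i) - n * μ := by simp
      rw [this, ← sq_abs (_ - _)]
      exact pow_le_pow_left₀ (by positivity) (le_of_lt hE) 2
    · rw [Set.indicator_of_notMem hE, zero_mul]
      positivity
  nlinarith

theorem tendsto_prob_iidPMF_deviation {α : Type*} [Fintype α] {P : α → ℝ} (hP : IsPMF P)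
    (φ : α → ℝ) {δ : ℝ} (hδ : 0 < δ) :
    Filter.Tendsto
      (fun n : ℕ => prob (iidPMF P n) {w | δ * n < |∑ i, φ (w i) - n * ∑ a, P a * φ a|})
      Filter.atTop (nhds 0) := by
  refine tendsto_of_tendsto_of_tendsto_of_le_of_le' tendsto_const_nhds
    (tendsto_const_div_atTop_nhds_zero_nat
      ((∑ a, P a * (φ a - ∑ b, P b * φ b) ^ 2) / δ ^ 2)) ?_ ?_
  · exact Filter.Eventually.of_forall fun n => prob_nonneg (iidPMF_nonneg hP) _
  · filter_upwards [Filter.eventually_gt_atTop 0] with n hn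
    exact prob_iidPMF_deviation_le hP φ hδ hn

/-- The empirical distribution of `h (w i)`, with `w` i.i.d., concentrates in total variation. -/
theorem tendsto_prob_tvDist_empDist {α β : Type*} [Fintype α] [Fintype β] {P : α → ℝ}
    (hP : IsPMF P) (h : α → β) {R : β → ℝ} (hR : ∀ b, R b = margProb P h b)
    {δ : ℝ} (hδ : 0 < δ) :
    Filter.Tendsto
      (fun n : ℕ => prob (iidPMF P n) {w | δ < tvDist (empDist fun i => h (w i)) R})
      Filter.atTop (nhds 0) := by
  classical
  set c : ℝ := (Fintype.card β : ℝ) + 1 with hc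
  have hc0 : 0 < c := by positivity
  set φ : β → α → ℝ := fun b a => if h a = b then 1 else 0 with hφ
  have hμ : ∀ b, ∑ a, P a * φ b a = R b := fun b => by
    rw [hR, margProb, prob]
    simp [hφ, Set.indicator_apply]
  have hlim := tendsto_finsetSum (Finset.univ : Finset β)
    fun b _ => tendsto_prob_iidPMF_deviation hP (φ b) (div_pos hδ hc0)
  rw [Finset.sum_const_zero] at hlim
  refine tendsto_of_tendsto_of_tendsto_of_le_of_le' tendsto_const_nhds hlim
    (Filter.Eventually.of_forall fun n => prob_nonneg (iidPMF_nonneg hP) _) ?_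
  filter_upwards [Filter.eventually_gt_atTop 0] with n hn
  have hn' : (0 : ℝ) < n := by exact_mod_cast hn
  refine (prob_mono (iidPMF_nonneg hP) fun w _ hw => ?_).trans
    (prob_iUnion_le (iidPMF_nonneg hP) _)
  by_contra hcon
  simp only [Set.mem_iUnion, Set.mem_ofPred_eq, not_exists, not_lt, hμ] at hcon
  have hb : ∀ b, |empDist (fun i => h (w i)) b - R b| ≤ δ / c := by
    intro b
    have he : empDist (fun i => h (w i)) b - R b = (∑ i, φ b (w i) - n * R b) / n := by
      simp only [empDist, hφ, Set.indicator_apply, Set.mem_ofPred_eq]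
      field_simp
    rw [he, abs_div, abs_of_pos hn', div_le_iff₀ hn']
    exact hcon b
  have hs : ∑ b, |empDist (fun i => h (w i)) b - R b| ≤ Fintype.card β * (δ / c) := by
    simpa using Finset.sum_le_sum fun b (_ : b ∈ Finset.univ) => hb b
  have h1 : (Fintype.card β : ℝ) * (δ / c) ≤ δ := by
    rw [mul_div_assoc', div_le_iff₀ hc0]
    nlinarith
  have hw' : δ < tvDist (empDist fun i => h (w i)) R := hw
  rw [tvDist] at hw'
  linarith

/-! ### One-shot random coding -/

open Classical in
/-- A codebook `c` determines an encoder choosing a codeword `x` whose conditional probability of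
leaving `G` is at most `η`, and a decoder choosing a codeword `x` with `B y x`. -/
theorem exists_code_of_codebook {S X Y : Type*} [Fintype Y] [Nonempty X]
    {W : X → Y → ℝ} (hW : ∀ x, IsPMF (W x)) (G : Set (S × X × Y)) (B : Y → X → Prop)
    (hGB : ∀ s x y, (s, x, y) ∈ G → B y x) {η : ℝ} (hη : 0 ≤ η)
    (A : S → X → Prop) (hA : ∀ s x, A s x → ∑ y, (if (s, x, y) ∈ G then 0 else W x y) ≤ η)
    {M : ℕ} (c : Fin M → X) :
    ∃ (f : S → X) (g : Y → X), ∀ s,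
      ∑ y, (if (s, f s, y) ∈ G ∧ g y = f s then 0 else W (f s) y)
        ≤ (if ∀ m, ¬ A s (c m) then 1 else 0) + η
          + ∑ m, ∑ m', if m ≠ m' then
              (if A s (c m) then 1 else 0) * ∑ y, W (c m) y * (if B y (c m') then 1 else 0)
            else 0 := by
  obtain ⟨x₀⟩ := ‹Nonempty X›
  set g : Y → X := fun y => if h : ∃ m, B y (c m) then c h.choose else x₀ with hg
  refine ⟨fun s => if h : ∃ m, A s (c m) then c h.choose else x₀, g, fun s => ?_⟩
  have hterm : ∀ m m', 0 ≤ if m ≠ m' then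
      (if A s (c m) then (1 : ℝ) else 0) * ∑ y, W (c m) y * (if B y (c m') then 1 else 0)
      else 0 := by
    intro m m'
    have : 0 ≤ ∑ y, W (c m) y * (if B y (c m') then (1 : ℝ) else 0) :=
      Finset.sum_nonneg fun y _ => mul_nonneg ((hW _).1 _) (by split_ifs <;> norm_num)
    split_ifs
    exacts [by rwa [one_mul], by rw [zero_mul], le_rfl]
  by_cases h : ∃ m, A s (c m)
  · simp only [dif_pos h]
    set m := h.choose
    have hm : A s (c m) := h.choose_spec
    have hy : ∀ y, (if (s, c m, y) ∈ G ∧ g y = c m then 0 else W (c m) y)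
        ≤ (if (s, c m, y) ∈ G then 0 else W (c m) y)
          + ∑ m', if m ≠ m' then W (c m) y * (if B y (c m') then 1 else 0) else 0 := by
      intro y
      have hWy := (hW (c m)).1 y
      have hn : ∀ m', 0 ≤ if m ≠ m' then W (c m) y * (if B y (c m') then (1 : ℝ) else 0) else 0 :=
        fun m' => by split_ifs <;> simp [hWy]
      have hsum := Finset.sum_nonneg fun m' (_ : m' ∈ Finset.univ) => hn m'
      by_cases hG : (s, c m, y) ∈ G
      · by_cases hgy : g y = c m
        · simpa [hG, hgy] using hsum
        · have hex : ∃ m, B y (c m) := ⟨m, hGB _ _ _ hG⟩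
          have hgv : g y = c hex.choose := by simp only [hg, dif_pos hex]
          have hne : m ≠ hex.choose := fun he => hgy (hgv.trans (congrArg c he.symm))
          have hle := Finset.single_le_sum (fun m' _ => hn m') (Finset.mem_univ hex.choose)
          rw [if_pos hne, if_pos hex.choose_spec, mul_one] at hle
          simpa [hG, hgy] using hle
      · simpa [hG] using hsum
    calc _ ≤ ∑ y, ((if (s, c m, y) ∈ G then 0 else W (c m) y)
          + ∑ m', if m ≠ m' then W (c m) y * (if B y (c m') then 1 else 0) else 0) :=
          Finset.sum_le_sum fun y _ => hy y
      _ = (∑ y, if (s, c m, y) ∈ G then 0 else W (c m) y)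
          + ∑ m', if m ≠ m' then
              (if A s (c m) then 1 else 0) * ∑ y, W (c m) y * (if B y (c m') then 1 else 0)
            else 0 := by
          rw [Finset.sum_add_distrib, Finset.sum_comm (s := (Finset.univ : Finset Y))]
          congr 1
          refine Finset.sum_congr rfl fun m' _ => ?_
          by_cases hmm : m ≠ m'
          · simp only [if_pos hmm, if_pos hm, one_mul]
          · simp only [if_neg hmm, Finset.sum_const_zero]
      _ ≤ _ := by
          have h1 := hA _ _ hm
          have h2 := Finset.single_le_sum
            (fun m₁ _ => Finset.sum_nonneg fun m' (_ : m' ∈ Finset.univ) => hterm m₁ m')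
            (Finset.mem_univ m)
          have h3 : ¬ ∀ m, ¬ A s (c m) := fun hn => hn m hm
          rw [if_neg h3, zero_add]
          exact add_le_add h1 h2
  · have h1 : ∀ m, ¬ A s (c m) := not_exists.1 h
    rw [if_pos h1]
    have h2 := Finset.sum_nonneg fun m (_ : m ∈ Finset.univ) =>
      Finset.sum_nonneg fun m' (_ : m' ∈ Finset.univ) => hterm m m'
    have h3 : ∀ x, ∑ y, (if (s, x, y) ∈ G ∧ g y = x then 0 else W x y) ≤ 1 := by
      intro x
      rw [← (hW x).2]
      refine Finset.sum_le_sum fun y _ => ?_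
      have := (hW x).1 y
      split_ifs <;> simp [this]
    refine (h3 _).trans ?_
    linarith

theorem one_sub_pow_le {u t b : ℝ} (hb : 0 < b) (ht0 : 0 ≤ t) (ht1 : t ≤ 1) (hu1 : u ≤ 1)
    (htu : t ≤ b * u) (M : ℕ) : (1 - u) ^ M ≤ 1 - t + Real.exp (-(M / b)) := by
  have h1 : (1 - u) ^ M ≤ Real.exp (-(t * (M / b))) := by
    calc (1 - u) ^ M ≤ Real.exp (-u) ^ M :=
          pow_le_pow_left₀ (by linarith) (Real.one_sub_le_exp_neg u) M
      _ = Real.exp (-(M * u)) := by rw [← Real.exp_nat_mul]; ring_nf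
      _ ≤ _ := by
          refine Real.exp_le_exp.2 (neg_le_neg ?_)
          have : t / b ≤ u := by rw [div_le_iff₀ hb]; linarith
          calc t * (M / b) = M * (t / b) := by ring
            _ ≤ M * u := by gcongr
  have h2 := convexOn_exp.2 (Set.mem_univ 0) (Set.mem_univ (-(M / b : ℝ)))
    (sub_nonneg.2 ht1) ht0 (by ring)
  simp only [smul_eq_mul, mul_zero, zero_add, Real.exp_zero, mul_one] at h2
  have h3 : t * Real.exp (-(M / b)) ≤ 1 * Real.exp (-(M / b)) := by gcongr
  rw [show -(t * (M / b)) = t * -(M / b) by ring] at h1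
  linarith

open Classical in
/-- One-shot joint source-channel random coding bound: if `G` has probability at least `1 - η²`
under `PX(x) V(s|x) W(y|x)` and the likelihood ratios are controlled on `G`, a codebook of size
`M` yields a code for which `(s, x, y) ∈ G` and `x` is decoded correctly, up to a small
probability. -/
theorem exists_code_oneShot {S X Y : Type*} [Fintype S] [Fintype X] [Fintype Y]
    {PX : X → ℝ} {V : X → S → ℝ} {W : X → Y → ℝ} {PS : S → ℝ} {PY : Y → ℝ}
    (hPX : IsPMF PX) (hV : ∀ x, IsPMF (V x)) (hW : ∀ x, IsPMF (W x))
    (hPS : ∀ s, PS s = ∑ x, PX x * V x s) (hPS0 : ∀ s, 0 < PS s)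
    (hPY : ∀ y, PY y = ∑ x, PX x * W x y) (hPY0 : ∀ y, 0 < PY y)
    (G : Set (S × X × Y)) {a b k η : ℝ} (ha : 0 < a) (hb : 0 < b) (hk : 0 < k)
    (hη : 0 < η) (hη1 : η < 1)
    (hG : ∀ s x y, (s, x, y) ∈ G →
      a * PS s ≤ V x s ∧ V x s ≤ b * PS s ∧ k * PY y ≤ W x y)
    (hGc : ∑ s, ∑ x, ∑ y, (if (s, x, y) ∈ G then 0 else PX x * V x s * W x y) ≤ η ^ 2)
    (M : ℕ) :
    ∃ (f : S → X) (g : Y → X),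
      ∑ s, ∑ y, (if (s, f s, y) ∈ G ∧ g y = f s then 0 else PS s * W (f s) y)
        ≤ 2 * η + Real.exp (-(M / b)) + M ^ 2 / (a * k) := by
  set A : S → X → Prop := fun s x => ∑ y, (if (s, x, y) ∈ G then 0 else W x y) ≤ η with hA
  set B : Y → X → Prop := fun y x => k * PY y ≤ W x y with hB
  have hne : Nonempty X := by
    by_contra hcon
    rw [not_nonempty_iff] at hcon
    simpa using hPX.2
  have hPS1 : ∑ s, PS s = 1 := by
    simp only [hPS]
    rw [Finset.sum_comm]
    simp [← Finset.mul_sum, (hV _).2, hPX.2]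
  have hAG : ∀ s x, A s x → ∃ y, (s, x, y) ∈ G := by
    intro s x h
    by_contra hcon
    push Not at hcon
    simp only [hA, hcon, if_false, (hW x).2] at h
    linarith
  -- the `Q`-probability of the complement of `A`
  set t : S → ℝ := fun s => (∑ x, if A s x then PX x * V x s else 0) / PS s with ht
  have ht0 : ∀ s, 0 ≤ t s := fun s => div_nonneg (Finset.sum_nonneg fun x _ => by
    split_ifs
    exacts [mul_nonneg (hPX.1 _) ((hV _).1 _), le_rfl]) (hPS0 s).le
  have ht1 : ∀ s, t s ≤ 1 := fun s => by
    rw [ht, div_le_one (hPS0 s), hPS]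
    refine Finset.sum_le_sum fun x _ => ?_
    split_ifs
    exacts [le_rfl, mul_nonneg (hPX.1 _) ((hV _).1 _)]
  have hQA : ∑ s, PS s * (1 - t s) ≤ η := by
    have h1 : ∀ s, PS s * (1 - t s) = ∑ x, if A s x then 0 else PX x * V x s := by
      intro s
      have := (hPS0 s).ne'
      rw [mul_sub, mul_one, ht, mul_div_cancel₀ _ this, hPS, ← Finset.sum_sub_distrib]
      refine Finset.sum_congr rfl fun x _ => ?_
      split_ifs <;> simp
    have h2 : η * ∑ s, PS s * (1 - t s) ≤ η ^ 2 := by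
      refine le_trans ?_ hGc
      rw [Finset.mul_sum]
      refine Finset.sum_le_sum fun s _ => ?_
      rw [h1, Finset.mul_sum]
      refine Finset.sum_le_sum fun x _ => ?_
      have hq := mul_nonneg (hPX.1 x) ((hV x).1 s)
      have h3 : ∑ y, (if (s, x, y) ∈ G then 0 else PX x * V x s * W x y)
          = PX x * V x s * ∑ y, if (s, x, y) ∈ G then 0 else W x y := by
        rw [Finset.mul_sum]
        exact Finset.sum_congr rfl fun y _ => by split_ifs <;> simp
      rw [h3]
      split_ifs with hAx
      · rw [mul_zero]
        exact mul_nonneg hq (Finset.sum_nonneg fun y _ => by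
          split_ifs
          exacts [le_rfl, (hW x).1 y])
      · rw [mul_comm]
        exact mul_le_mul_of_nonneg_left (not_le.1 hAx).le hq
    nlinarith
  -- the probability that an independent codeword is suitable for `s`
  set u : S → ℝ := fun s => ∑ x, PX x * (if A s x then 1 else 0) with hu
  have hu1 : ∀ s, u s ≤ 1 := fun s => by
    rw [← hPX.2]
    refine Finset.sum_le_sum fun x _ => ?_
    have := hPX.1 x
    split_ifs <;> simp [this]
  have htu : ∀ s, t s ≤ b * u s := fun s => by
    rw [ht, div_le_iff₀ (hPS0 s), hu, Finset.mul_sum, Finset.sum_mul]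
    refine Finset.sum_le_sum fun x _ => ?_
    split_ifs with hAx
    · obtain ⟨y, hy⟩ := hAG s x hAx
      nlinarith [mul_le_mul_of_nonneg_left (hG s x y hy).2.1 (hPX.1 x)]
    · simp
  have hua : ∀ s, u s ≤ 1 / a := fun s => by
    rw [le_div_iff₀ ha]
    have h1 : u s * a * PS s ≤ 1 * PS s := by
      rw [one_mul, hPS s, ← hPS s, hu, Finset.sum_mul, Finset.sum_mul]
      conv_rhs => rw [hPS s]
      refine Finset.sum_le_sum fun x _ => ?_
      split_ifs with hAx
      · obtain ⟨y, hy⟩ := hAG s x hAx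
        nlinarith [mul_le_mul_of_nonneg_left (hG s x y hy).1 (hPX.1 x)]
      · simpa using mul_nonneg (hPX.1 x) ((hV x).1 s)
    exact le_of_mul_le_mul_right h1 (hPS0 s)
  have hBk : ∀ y, ∑ x, PX x * (if B y x then (1 : ℝ) else 0) ≤ 1 / k := fun y => by
    rw [le_div_iff₀ hk]
    refine le_of_mul_le_mul_right ?_ (hPY0 y)
    rw [one_mul, Finset.sum_mul, Finset.sum_mul]
    conv_rhs => rw [hPY y]
    refine Finset.sum_le_sum fun x _ => ?_
    split_ifs with hBx
    · nlinarith [mul_le_mul_of_nonneg_left hBx (hPX.1 x)]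
    · simpa using mul_nonneg (hPX.1 x) ((hW x).1 y)
  -- averaging over random codebooks
  set bound : (Fin M → X) → S → ℝ := fun c s =>
    (if ∀ m, ¬ A s (c m) then 1 else 0) + η
      + ∑ m, ∑ m', if m ≠ m' then
          (if A s (c m) then 1 else 0) * ∑ y, W (c m) y * (if B y (c m') then 1 else 0)
        else 0 with hbound
  have hcover : ∀ s, ∑ c : Fin M → X, iidPMF PX M c * (if ∀ m, ¬ A s (c m) then 1 else 0)
      ≤ 1 - t s + Real.exp (-(M / b)) := by
    intro s
    have h1 := sum_iidPMF_mul_prod PX (n := M) fun _ x => if A s x then 0 else 1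
    have h2 : ∑ x, PX x * (if A s x then 0 else 1) = 1 - u s := by
      rw [eq_sub_iff_add_eq, hu, ← Finset.sum_add_distrib]
      refine Eq.trans (Finset.sum_congr rfl fun x _ => ?_) hPX.2
      split_ifs <;> simp
    have h3 : ∀ c : Fin M → X, ∏ i, (if A s (c i) then (0 : ℝ) else 1)
        = if ∀ m, ¬ A s (c m) then 1 else 0 := by
      intro c
      split_ifs with h
      · exact Finset.prod_eq_one fun i _ => if_neg (h i)
      · push Not at h
        obtain ⟨m, hm⟩ := h
        exact Finset.prod_eq_zero (Finset.mem_univ m) (if_pos hm)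
    simp only [h2, h3, Finset.prod_const, Finset.card_univ, Fintype.card_fin] at h1
    rw [h1]
    exact one_sub_pow_le hb (ht0 s) (ht1 s) (hu1 s) (htu s) M
  have hpack : ∀ s (m m' : Fin M), ∑ c : Fin M → X, iidPMF PX M c * (if m ≠ m' then
      (if A s (c m) then 1 else 0) * ∑ y, W (c m) y * (if B y (c m') then 1 else 0) else 0)
      ≤ 1 / (a * k) := by
    intro s m m'
    by_cases hmm : m = m'
    · simp only [hmm, ne_eq, not_true_eq_false, if_false, mul_zero, Finset.sum_const_zero]
      positivity
    · simp only [ne_eq, hmm, not_false_eq_true, if_true]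
      calc _ = ∑ y, ∑ c : Fin M → X, iidPMF PX M c *
              (((if A s (c m) then 1 else 0) * W (c m) y) * (if B y (c m') then 1 else 0)) := by
            rw [Finset.sum_comm]
            refine Finset.sum_congr rfl fun c _ => ?_
            rw [Finset.mul_sum, Finset.mul_sum]
            exact Finset.sum_congr rfl fun y _ => by ring
        _ = ∑ y, (∑ x, PX x * ((if A s x then 1 else 0) * W x y))
              * ∑ x, PX x * (if B y x then (1 : ℝ) else 0) :=
            Finset.sum_congr rfl fun y _ => sum_iidPMF_mul_mul hPX hmm
              (fun x => (if A s x then 1 else 0) * W x y) (fun x => if B y x then 1 else 0)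
        _ ≤ ∑ y, (∑ x, PX x * ((if A s x then 1 else 0) * W x y)) * (1 / k) := by
            refine Finset.sum_le_sum fun y _ => mul_le_mul_of_nonneg_left (hBk y) ?_
            refine Finset.sum_nonneg fun x _ => mul_nonneg (hPX.1 x) (mul_nonneg ?_ ((hW x).1 y))
            split_ifs <;> norm_num
        _ = u s * (1 / k) := by
            rw [← Finset.sum_mul, Finset.sum_comm, hu]
            simp only [← Finset.mul_sum, (hW _).2, mul_one]
        _ ≤ 1 / a * (1 / k) := by
            have := hua s
            gcongr
        _ = 1 / (a * k) := by field_simp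
  have havg : ∀ s, ∑ c, iidPMF PX M c * bound c s
      ≤ (1 - t s) + (Real.exp (-(M / b)) + η + M ^ 2 / (a * k)) := by
    intro s
    simp only [hbound, mul_add, Finset.sum_add_distrib]
    have h1 : ∑ c, iidPMF PX M c * η = η := by
      rw [← Finset.sum_mul, (isPMF_iidPMF hPX M).2, one_mul]
    have h2 : ∑ c : Fin M → X, iidPMF PX M c * (∑ m, ∑ m', if m ≠ m' then
        (if A s (c m) then 1 else 0) * ∑ y, W (c m) y * (if B y (c m') then 1 else 0) else 0)
        ≤ M ^ 2 / (a * k) := by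
      calc _ = ∑ m, ∑ m', ∑ c : Fin M → X, iidPMF PX M c * (if m ≠ m' then
            (if A s (c m) then 1 else 0) * ∑ y, W (c m) y * (if B y (c m') then 1 else 0)
            else 0) := by
            simp only [Finset.mul_sum]
            rw [Finset.sum_comm]
            exact Finset.sum_congr rfl fun m _ => Finset.sum_comm
        _ ≤ ∑ _m : Fin M, ∑ _m' : Fin M, 1 / (a * k) :=
            Finset.sum_le_sum fun m _ => Finset.sum_le_sum fun m' _ => hpack s m m'
        _ = M ^ 2 / (a * k) := by
            simp only [Finset.sum_const, Finset.card_univ, Fintype.card_fin, nsmul_eq_mul]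
            ring
    have h3 := hcover s
    linarith
  have htotal : ∑ c, iidPMF PX M c * ∑ s, PS s * bound c s
      ≤ ∑ c, iidPMF PX M c * (2 * η + Real.exp (-(M / b)) + M ^ 2 / (a * k)) := by
    rw [← Finset.sum_mul, (isPMF_iidPMF hPX M).2, one_mul]
    calc _ = ∑ s, PS s * ∑ c, iidPMF PX M c * bound c s := by
          simp only [Finset.mul_sum]
          rw [Finset.sum_comm]
          exact Finset.sum_congr rfl fun s _ => Finset.sum_congr rfl fun c _ => by ring
      _ ≤ ∑ s, PS s * ((1 - t s) + (Real.exp (-(M / b)) + η + M ^ 2 / (a * k))) :=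
          Finset.sum_le_sum fun s _ => mul_le_mul_of_nonneg_left (havg s) (hPS0 s).le
      _ = ∑ s, PS s * (1 - t s) + (Real.exp (-(M / b)) + η + M ^ 2 / (a * k)) := by
          simp only [mul_add (PS _) (1 - t _), Finset.sum_add_distrib]
          rw [← Finset.sum_mul, hPS1, one_mul]
      _ ≤ _ := by linarith
  have hgood : ∃ c, ∑ s, PS s * bound c s
      ≤ 2 * η + Real.exp (-(M / b)) + M ^ 2 / (a * k) := by
    by_contra hcon
    push Not at hcon
    have hpos : ∃ c, 0 < iidPMF PX M c := by
      by_contra hz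
      push Not at hz
      have h1 := Finset.sum_nonpos fun c (_ : c ∈ Finset.univ) => hz c
      have h2 : ∑ c, iidPMF PX M c = 1 := (isPMF_iidPMF hPX M).2
      linarith
    obtain ⟨c₀, hc₀⟩ := hpos
    refine absurd htotal (not_le.2 (Finset.sum_lt_sum
      (fun c _ => mul_le_mul_of_nonneg_left (hcon c).le (iidPMF_nonneg hPX c))
      ⟨c₀, Finset.mem_univ _, mul_lt_mul_of_pos_left (hcon c₀) hc₀⟩))
  obtain ⟨c, hc⟩ := hgood
  obtain ⟨f, g, hfg⟩ := exists_code_of_codebook hW G B (fun s x y h => (hG s x y h).2.2) hη.le A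
    (fun _ _ h => h) c
  refine ⟨f, g, le_trans (Finset.sum_le_sum fun s _ => ?_) hc⟩
  refine le_trans (le_of_eq ?_) (mul_le_mul_of_nonneg_left (hfg s) (hPS0 s).le)
  rw [Finset.mul_sum]
  exact Finset.sum_congr rfl fun y _ => by split_ifs <;> simp

/-! ### Achievability for long blocks -/

theorem sum_arrow_triple {ι S X Y : Type*} [Fintype ι] [DecidableEq ι] [Fintype S] [Fintype X]
    [Fintype Y] (F : (ι → S × X × Y) → ℝ) :
    ∑ w, F w = ∑ s : ι → S, ∑ x : ι → X, ∑ y : ι → Y, F fun i => (s i, x i, y i) := by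
  let e : (ι → S × X × Y) ≃ (ι → S) × (ι → X) × (ι → Y) :=
    (Equiv.arrowProdEquivProdArrow ι (fun _ => S) fun _ => X × Y).trans
      ((Equiv.refl _).prodCongr (Equiv.arrowProdEquivProdArrow ι (fun _ => X) fun _ => Y))
  rw [← e.symm.sum_comp, Fintype.sum_prod_type]
  refine Finset.sum_congr rfl fun s _ => ?_
  rw [Fintype.sum_prod_type]
  rfl

theorem prod_eq_exp_sum_log_sub_mul {ι : Type*} [Fintype ι] {v r : ι → ℝ}
    (hv : ∀ i, 0 < v i) (hr : ∀ i, 0 < r i) :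
    ∏ i, v i = Real.exp (∑ i, (Real.log (v i) - Real.log (r i))) * ∏ i, r i := by
  rw [Real.exp_sum, ← Finset.prod_mul_distrib]
  refine Finset.prod_congr rfl fun i _ => ?_
  rw [Real.exp_sub, Real.exp_log (hv i), Real.exp_log (hr i), div_mul_cancel₀ _ (hr i).ne']

/-- The output law of a memoryless channel with i.i.d. input is i.i.d. -/
theorem prod_eq_sum_iidPMF_mul_prod {X Z : Type*} [Fintype X] {PX : X → ℝ} {U : X → Z → ℝ}
    {PZ : Z → ℝ} (hPZ : ∀ z, PZ z = ∑ x, PX x * U x z) {n : ℕ} (z : Fin n → Z) :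
    ∏ i, PZ (z i) = ∑ x : Fin n → X, iidPMF PX n x * ∏ i, U (x i) (z i) := by
  rw [sum_iidPMF_mul_prod PX fun i x => U x (z i)]
  simp only [hPZ]

/-- Gibbs' inequality. -/
theorem sum_mul_log_sub_log_nonneg {S : Type*} [Fintype S] {v r : S → ℝ} (hv : IsPMF v)
    (hr : ∑ s, r s = 1) (hr0 : ∀ s, 0 < r s) :
    0 ≤ ∑ s, v s * (Real.log (v s) - Real.log (r s)) := by
  have h : ∑ s, (v s - r s) ≤ ∑ s, v s * (Real.log (v s) - Real.log (r s)) := by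
    refine Finset.sum_le_sum fun s _ => ?_
    rcases (hv.1 s).eq_or_lt with h0 | h0
    · simpa [← h0] using (hr0 s).le
    · have h1 := Real.log_le_sub_one_of_pos (div_pos (hr0 s) h0)
      rw [Real.log_div (hr0 s).ne' h0.ne'] at h1
      have h2 := mul_le_mul_of_nonneg_left h1 h0.le
      rw [mul_sub, mul_sub, mul_one, mul_div_cancel₀ _ h0.ne'] at h2
      linarith
  rwa [Finset.sum_sub_distrib, hv.2, hr, sub_self] at h

/-- If `I(S;X) < I(X;Y)` under the law `PX(x) V(s|x) W(y|x)`, then this law together with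
`Ŝ = X` is achievable with a noncausal encoder. -/
theorem achievable_noncausal_of_lt {S X Y : Type*} [Fintype S] [Fintype X] [Fintype Y]
    [DecidableEq X]
    {PX : X → ℝ} {V : X → S → ℝ} {W : X → Y → ℝ} {PS : S → ℝ} {PY : Y → ℝ}
    (hPX : IsPMF PX) (hV : ∀ x, IsPMF (V x)) (hW : ∀ x, IsPMF (W x))
    (hPS : ∀ s, PS s = ∑ x, PX x * V x s) (hPS0 : ∀ s, 0 < PS s)
    (hPY : ∀ y, PY y = ∑ x, PX x * W x y) (hPY0 : ∀ y, 0 < PY y)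
    (hI : ∑ x, PX x * ∑ s, V x s * (Real.log (V x s) - Real.log (PS s))
      < ∑ x, PX x * ∑ y, W x y * (Real.log (W x y) - Real.log (PY y)))
    {P : S × X × Y × X → ℝ}
    (hP : ∀ s x y z, P (s, x, y, z) = if z = x then PX x * V x s * W x y else 0) :
    Achievable PS W EncoderClass.noncausal P := by
  classical
  set I₁ := ∑ x, PX x * ∑ s, V x s * (Real.log (V x s) - Real.log (PS s)) with hI₁
  set I₂ := ∑ x, PX x * ∑ y, W x y * (Real.log (W x y) - Real.log (PY y)) with hI₂
  set Q : S × X × Y → ℝ := fun t => PX t.2.1 * V t.2.1 t.1 * W t.2.1 t.2.2 with hQ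
  set φ₁ : S × X × Y → ℝ := fun t => Real.log (V t.2.1 t.1) - Real.log (PS t.1) with hφ₁
  set φ₂ : S × X × Y → ℝ := fun t => Real.log (W t.2.1 t.2.2) - Real.log (PY t.2.2) with hφ₂
  have hPS1 : ∑ s, PS s = 1 := by
    simp only [hPS]
    rw [Finset.sum_comm]
    simp [← Finset.mul_sum, (hV _).2, hPX.2]
  have hI₁0 : 0 ≤ I₁ := Finset.sum_nonneg fun x _ =>
    mul_nonneg (hPX.1 x) (sum_mul_log_sub_log_nonneg (hV x) hPS1 hPS0)
  have hsum : ∀ F : S × X × Y → ℝ, ∑ t, F t = ∑ x, ∑ s, ∑ y, F (s, x, y) := fun F => by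
    simp only [Fintype.sum_prod_type]
    exact Finset.sum_comm
  have hQpmf : IsPMF Q := by
    refine ⟨fun t => mul_nonneg (mul_nonneg (hPX.1 _) ((hV _).1 _)) ((hW _).1 _), ?_⟩
    rw [hsum]
    simp only [hQ, ← Finset.mul_sum, (hW _).2, (hV _).2, mul_one, hPX.2]
  have hμ₁ : ∑ t, Q t * φ₁ t = I₁ := by
    rw [hsum, hI₁]
    refine Finset.sum_congr rfl fun x _ => ?_
    rw [Finset.mul_sum]
    refine Finset.sum_congr rfl fun s _ => ?_
    simp only [hQ, hφ₁]
    rw [← Finset.sum_mul, ← Finset.mul_sum, (hW x).2]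
    ring
  have hμ₂ : ∑ t, Q t * φ₂ t = I₂ := by
    rw [hsum, hI₂]
    refine Finset.sum_congr rfl fun x _ => ?_
    rw [Finset.sum_comm, Finset.mul_sum]
    refine Finset.sum_congr rfl fun y _ => ?_
    simp only [hQ, hφ₂]
    rw [← Finset.sum_mul, ← Finset.sum_mul, ← Finset.mul_sum, (hV x).2]
    ring
  have hmarg : ∀ b, P b = margProb Q (fun t => (t.1, t.2.1, t.2.2, t.2.1)) b := by
    rintro ⟨s, x, y, z⟩
    rw [hP, margProb, prob, Finset.sum_eq_single (s, x, y)]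
    · by_cases hz : z = x
      · simp [hz, hQ]
      · simp [hz, Ne.symm hz]
    · rintro ⟨s', x', y'⟩ _ hne
      refine Set.indicator_of_notMem (fun hmem => hne ?_) _
      simp only [Set.mem_ofPred_eq, Prod.mk.injEq] at hmem
      simp [hmem]
    · exact fun h => absurd (Finset.mem_univ _) h
  set δ := (I₂ - I₁) / 7 with hδ
  have hδ0 : 0 < δ := by
    rw [hδ]
    linarith
  intro ε hε
  set η := min (ε / 4) (1 / 2) with hη
  have hη0 : 0 < η := lt_min (by linarith) (by norm_num)
  have hη1 : η < 1 := (min_le_right _ _).trans_lt (by norm_num)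
  have hηε : η ≤ ε / 4 := min_le_left _ _
  have htyp := ((tendsto_prob_tvDist_empDist hQpmf _ hmarg hε).add
    (tendsto_prob_iidPMF_deviation hQpmf φ₁ hδ0)).add
    (tendsto_prob_iidPMF_deviation hQpmf φ₂ hδ0)
  simp only [add_zero] at htyp
  have hnδ : Filter.Tendsto (fun n : ℕ => (n : ℝ) * δ) Filter.atTop Filter.atTop :=
    tendsto_natCast_atTop_atTop.atTop_mul_const hδ0
  have hexp₁ := Real.tendsto_exp_neg_atTop_nhds_zero.comp (Real.tendsto_exp_atTop.comp hnδ)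
  have hexp₂ := (Real.tendsto_exp_neg_atTop_nhds_zero.comp hnδ).const_mul 4
  rw [mul_zero] at hexp₂
  obtain ⟨n, hn, hn₁, hn₂, hn₃⟩ := ((Filter.eventually_gt_atTop 0).and
    ((htyp.eventually_lt_const (pow_pos hη0 2)).and
      ((hexp₁.eventually_lt_const (show 0 < ε / 4 by linarith)).and
        (hexp₂.eventually_lt_const (show 0 < ε / 4 by linarith))))).exists
  simp only [Function.comp_apply, hμ₁, hμ₂] at hn₁ hn₂ hn₃
  set T₁ : Set (Fin n → S × X × Y) :=
    {w | ε < tvDist (empDist fun i => ((w i).1, (w i).2.1, (w i).2.2, (w i).2.1)) P} with hT₁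
  set T₂ : Set (Fin n → S × X × Y) := {w | δ * n < |∑ i, φ₁ (w i) - n * I₁|} with hT₂
  set T₃ : Set (Fin n → S × X × Y) := {w | δ * n < |∑ i, φ₂ (w i) - n * I₂|} with hT₃
  set G : Set ((Fin n → S) × (Fin n → X) × (Fin n → Y)) :=
    {t | (fun i => (t.1 i, t.2.1 i, t.2.2 i)) ∉ T₁ ∪ T₂ ∪ T₃ ∧
      iidPMF Q n (fun i => (t.1 i, t.2.1 i, t.2.2 i)) ≠ 0} with hG
  have hbad : prob (iidPMF Q n) (T₁ ∪ T₂ ∪ T₃) ≤ η ^ 2 := by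
    have h1 := prob_union_le (iidPMF_nonneg hQpmf) (T₁ ∪ T₂) T₃
    have h2 := prob_union_le (iidPMF_nonneg hQpmf) T₁ T₂
    linarith
  set M := ⌈Real.exp (n * (I₁ + 2 * δ))⌉₊ with hM
  have hM₁ : Real.exp (n * (I₁ + 2 * δ)) ≤ M := Nat.le_ceil _
  have hM₂ : (M : ℝ) ≤ 2 * Real.exp (n * (I₁ + 2 * δ)) := by
    have h1 := Nat.ceil_lt_add_one (Real.exp_pos (n * (I₁ + 2 * δ))).le
    have h2 : (1 : ℝ) ≤ Real.exp (n * (I₁ + 2 * δ)) := Real.one_le_exp (by positivity)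
    rw [← hM] at h1
    linarith
  obtain ⟨f, g, hfg⟩ := exists_code_oneShot
    (V := fun x s => ∏ i, V (x i) (s i)) (W := fun x y => ∏ i, W (x i) (y i))
    (PS := fun s => ∏ i, PS (s i)) (PY := fun y => ∏ i, PY (y i))
    (isPMF_iidPMF hPX n) (fun x => isPMF_pi fun i => hV (x i)) (fun x => isPMF_pi fun i => hW (x i))
    (prod_eq_sum_iidPMF_mul_prod hPS) (fun s => Finset.prod_pos fun i _ => hPS0 (s i))
    (prod_eq_sum_iidPMF_mul_prod hPY) (fun y => Finset.prod_pos fun i _ => hPY0 (y i))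
    G (Real.exp_pos (n * (I₁ - δ))) (Real.exp_pos (n * (I₁ + δ))) (Real.exp_pos (n * (I₂ - δ)))
    hη0 hη1 (by
      rintro s x y ⟨hT, hpos⟩
      have hne := fun i => Finset.prod_ne_zero_iff.1 hpos i (Finset.mem_univ i)
      simp only [hQ, mul_ne_zero_iff] at hne
      have hVpos : ∀ i, 0 < V (x i) (s i) := fun i =>
        lt_of_le_of_ne ((hV _).1 _) (hne i).1.2.symm
      have hWpos : ∀ i, 0 < W (x i) (y i) := fun i =>
        lt_of_le_of_ne ((hW _).1 _) (hne i).2.symm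
      simp only [Set.mem_union, not_or, hT₂, hT₃, Set.mem_ofPred_eq, not_lt, abs_le, hφ₁,
        hφ₂] at hT
      obtain ⟨⟨-, h2l, h2u⟩, h3l, -⟩ := hT
      rw [prod_eq_exp_sum_log_sub_mul hVpos fun i => hPS0 (s i),
        prod_eq_exp_sum_log_sub_mul hWpos fun i => hPY0 (y i)]
      have hS := Finset.prod_nonneg fun i (_ : i ∈ Finset.univ) => (hPS0 (s i)).le
      have hY := Finset.prod_nonneg fun i (_ : i ∈ Finset.univ) => (hPY0 (y i)).le
      refine ⟨mul_le_mul_of_nonneg_right (Real.exp_le_exp.2 ?_) hS,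
        mul_le_mul_of_nonneg_right (Real.exp_le_exp.2 ?_) hS,
        mul_le_mul_of_nonneg_right (Real.exp_le_exp.2 ?_) hY⟩ <;> linarith)
    (by
      refine le_trans (le_of_eq ?_) hbad
      rw [prob, sum_arrow_triple]
      refine Finset.sum_congr rfl fun s _ => Finset.sum_congr rfl fun x _ =>
        Finset.sum_congr rfl fun y _ => ?_
      have hw : iidPMF Q n (fun i => (s i, x i, y i))
          = iidPMF PX n x * (∏ i, V (x i) (s i)) * ∏ i, W (x i) (y i) := by
        simp only [iidPMF, hQ, Finset.prod_mul_distrib]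
      rw [← hw, Set.indicator_apply]
      by_cases h0 : iidPMF Q n (fun i => (s i, x i, y i)) = 0
      · simp [h0]
      · by_cases hT : (fun i => (s i, x i, y i)) ∈ T₁ ∪ T₂ ∪ T₃
        · rw [if_pos hT, if_neg fun h => h.1 hT]
        · rw [if_neg hT, if_pos ⟨hT, h0⟩])
    M
  refine ⟨n, hn, fun i s => f s i, fun i y => g y i, trivial, lt_of_le_of_lt ?_
    (lt_of_le_of_lt hfg ?_)⟩
  · rw [prob, Fintype.sum_prod_type]
    refine Finset.sum_le_sum fun s _ => Finset.sum_le_sum fun y _ => ?_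
    have hnn : 0 ≤ inducedP PS W (fun i s => f s i) (s, y) :=
      mul_nonneg (Finset.prod_nonneg fun i _ => (hPS0 _).le)
        (Finset.prod_nonneg fun i _ => (hW _).1 _)
    by_cases hgd : (s, f s, y) ∈ G ∧ g y = f s
    · rw [if_pos hgd]
      refine (Set.indicator_of_notMem (fun hmem => hgd.1.1 (Or.inl (Or.inl ?_))) _).le
      rw [Set.mem_ofPred_eq] at hmem
      simp only [hgd.2] at hmem
      exact hmem
    · rw [if_neg hgd]
      exact Set.indicator_le_self' (fun _ _ => hnn) _
  · have h1 : Real.exp (-(M / Real.exp (n * (I₁ + δ)))) ≤ Real.exp (-Real.exp (n * δ)) := by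
      refine Real.exp_le_exp.2 (neg_le_neg ?_)
      rw [le_div_iff₀ (Real.exp_pos _), ← Real.exp_add]
      refine le_trans (le_of_eq ?_) hM₁
      ring_nf
    have h2 : (M : ℝ) ^ 2 / (Real.exp (n * (I₁ - δ)) * Real.exp (n * (I₂ - δ)))
        ≤ 4 * Real.exp (-(n * δ)) := by
      rw [div_le_iff₀ (by positivity)]
      calc (M : ℝ) ^ 2 ≤ (2 * Real.exp (n * (I₁ + 2 * δ))) ^ 2 := by gcongr
        _ = 4 * (Real.exp (n * (I₁ + 2 * δ)) * Real.exp (n * (I₁ + 2 * δ))) := by ring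
        _ = 4 * Real.exp (-(n * δ))
            * (Real.exp (n * (I₁ - δ)) * Real.exp (n * (I₂ - δ))) := by
            rw [mul_assoc, ← Real.exp_add, ← Real.exp_add, ← Real.exp_add]
            congr 2
            rw [hδ]
            ring
    linarith

theorem tvDist_triangle {α : Type*} [Fintype α] (P Q R : α → ℝ) :
    tvDist P R ≤ tvDist P Q + tvDist Q R := by
  unfold tvDist
  rw [← add_div, ← Finset.sum_add_distrib]
  gcongr
  exact abs_sub_le _ _ _

theorem inducedP_nonneg {S X Y : Type*} [Fintype S] [Fintype Y] {PS : S → ℝ} {PYX : X → Y → ℝ}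
    (hPS : ∀ s, 0 ≤ PS s) (hPYX : ∀ x y, 0 ≤ PYX x y) {n : ℕ} (f : Fin n → (Fin n → S) → X)
    (sy : (Fin n → S) × (Fin n → Y)) : 0 ≤ inducedP PS PYX f sy :=
  mul_nonneg (Finset.prod_nonneg fun _ _ => hPS _) (Finset.prod_nonneg fun _ _ => hPYX _ _)

/-- The set of achievable laws is closed. -/
theorem achievable_of_forall_tvDist_lt {S X Y Z : Type*} [Fintype S] [Fintype X] [Fintype Y]
    [Fintype Z] {PS : S → ℝ} {PYX : X → Y → ℝ} (hPS : ∀ s, 0 ≤ PS s) (hPYX : ∀ x y, 0 ≤ PYX x y)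
    {c : EncoderClass} {P : S × X × Y × Z → ℝ}
    (h : ∀ δ > 0, ∃ P', tvDist P' P < δ ∧ Achievable PS PYX c P') : Achievable PS PYX c P := by
  intro ε hε
  obtain ⟨P', hP', hach⟩ := h (ε / 2) (half_pos hε)
  obtain ⟨n, hn, f, g, hf, hfg⟩ := hach (ε / 2) (half_pos hε)
  refine ⟨n, hn, f, g, hf, (lt_of_le_of_lt ?_ hfg).trans (half_lt_self hε)⟩
  refine prob_mono (inducedP_nonneg hPS hPYX f) fun sy _ hsy => ?_
  rw [Set.mem_ofPred_eq] at hsy ⊢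
  have := tvDist_triangle (empDist fun i => (sy.1 i, f i sy.1, sy.2 i, g i sy.2)) P' P
  linarith

/-- A constant channel input `x₀` together with a constant reconstruction `z₀` is achievable. -/
theorem achievable_const {S X Y Z : Type*} [Fintype S] [Fintype X] [Fintype Y] [Fintype Z]
    {PS : S → ℝ} {PYX : X → Y → ℝ} (hPS : IsPMF PS) (hPYX : ∀ x, IsPMF (PYX x)) (x₀ : X) (z₀ : Z)
    {P : S × X × Y × Z → ℝ}
    (hP : ∀ b, P b = margProb (fun t : S × Y => PS t.1 * PYX x₀ t.2)
      (fun t => (t.1, x₀, t.2, z₀)) b) :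
    Achievable PS PYX EncoderClass.noncausal P := by
  intro ε hε
  have hQ : IsPMF fun t : S × Y => PS t.1 * PYX x₀ t.2 := by
    refine ⟨fun t => mul_nonneg (hPS.1 _) ((hPYX _).1 _), ?_⟩
    rw [Fintype.sum_prod_type]
    simp only [← Finset.mul_sum, (hPYX _).2, mul_one, hPS.2]
  obtain ⟨n, hn, hn'⟩ := ((Filter.eventually_gt_atTop 0).and
    ((tendsto_prob_tvDist_empDist hQ _ hP hε).eventually_lt_const hε)).exists
  refine ⟨n, hn, fun _ _ => x₀, fun _ _ => z₀, trivial, lt_of_eq_of_lt ?_ hn'⟩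
  rw [prob, prob,
    ← (Equiv.arrowProdEquivProdArrow (Fin n) (fun _ => S) fun _ => Y).sum_comp]
  refine Finset.sum_congr rfl fun w _ => ?_
  simp only [Set.indicator, Set.mem_ofPred_eq, inducedP, iidPMF, Finset.prod_mul_distrib]
  rfl

/-! ### The binary symmetric channel -/

/-- The transition probabilities of the binary symmetric channel. -/
def bsc (e : ℝ) (x y : Bool) : ℝ := if y = x then 1 - e else e

theorem isPMF_bsc {e : ℝ} (h0 : 0 ≤ e) (h1 : e ≤ 1) (x : Bool) : IsPMF (bsc e x) := by
  refine ⟨fun y => ?_, ?_⟩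
  · unfold bsc
    split_ifs <;> linarith
  · cases x <;> simp [bsc]

/-- The Bernoulli distribution. -/
def bern (q : ℝ) (x : Bool) : ℝ := if x then q else 1 - q

theorem isPMF_bern {q : ℝ} (h0 : 0 ≤ q) (h1 : q ≤ 1) : IsPMF (bern q) := by
  refine ⟨fun x => ?_, by simp [bern]⟩
  unfold bern
  split_ifs <;> linarith

theorem bern_eq_sum_bsc (q e : ℝ) (y : Bool) :
    bern (q + e - 2 * q * e) y = ∑ x, bern q x * bsc e x y := by
  cases y <;> simp [bern, bsc] <;> ring

theorem bern_pos {q : ℝ} (h0 : 0 < q) (h1 : q < 1) (x : Bool) : 0 < bern q x := by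
  unfold bern
  split_ifs <;> linarith

/-- The mutual information across a binary symmetric channel with Bernoulli input. -/
theorem sum_bern_bsc_log (q e : ℝ) :
    ∑ x, bern q x * ∑ y, bsc e x y *
        (Real.log (bsc e x y) - Real.log (bern (q + e - 2 * q * e) y))
      = Real.binEntropy (q + e - 2 * q * e) - Real.binEntropy e := by
  simp [bern, bsc, Real.binEntropy]
  ring

theorem binEntropy_sub_lt {q e d : ℝ} (hq0 : 0 < q) (hq1 : q ≤ 1 / 2) (he : 0 ≤ e) (hed : e < d)
    (hd : d < 1 / 2) :
    Real.binEntropy (q + d - 2 * q * d) - Real.binEntropy d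
      < Real.binEntropy (q + e - 2 * q * e) - Real.binEntropy e := by
  set u := q + e - 2 * q * e with hu
  set v := q + d - 2 * q * d with hv
  have huv : u ≤ v := by nlinarith
  have hev : e < v := by nlinarith
  have heu : e < u := by nlinarith
  have hdv : d < v := by nlinarith
  have hv2 : v ≤ 1 / 2 := by nlinarith
  have hmono : Real.binEntropy e < Real.binEntropy v :=
    Real.binEntropy_strictMonoOn ⟨he, by norm_num; linarith⟩ ⟨by linarith, by norm_num; linarith⟩ hev
  have hconc := Real.strictConcave_binEntropy.concaveOn.2
    (show e ∈ Set.Icc (0 : ℝ) 1 from ⟨he, by linarith⟩)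
    (show v ∈ Set.Icc (0 : ℝ) 1 from ⟨by linarith, by linarith⟩)
  have hL : 0 < v - e := by linarith
  have key : ∀ w, e ≤ w → w ≤ v →
      (v - w) * Real.binEntropy e + (w - e) * Real.binEntropy v ≤ (v - e) * Real.binEntropy w := by
    intro w h1 h2
    have h := hconc (div_nonneg (sub_nonneg.2 h2) hL.le) (div_nonneg (sub_nonneg.2 h1) hL.le)
      (by field_simp; ring)
    have hw : ((v - w) / (v - e)) • e + ((w - e) / (v - e)) • v = w := by
      simp only [smul_eq_mul]
      field_simp
      ring
    rw [hw] at h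
    simp only [smul_eq_mul] at h
    have h3 := mul_le_mul_of_nonneg_left h hL.le
    refine le_trans (le_of_eq ?_) h3
    field_simp
  have hk1 := key u heu.le huv
  have hk2 := key d hed.le hdv.le
  have hgap : 0 < (u - e) - (v - d) := by
    rw [hu, hv]
    nlinarith
  have hprod := mul_pos hgap (sub_pos.2 hmono)
  have : 0 < (v - e) * ((Real.binEntropy u - Real.binEntropy e)
      - (Real.binEntropy v - Real.binEntropy d)) := by nlinarith
  have := (mul_pos_iff_of_pos_left hL).1 this
  linarith

/-- The joint law of `(S, X, Y, X)` for `X ∼ Bern(q)`, observed through two independent binary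
symmetric channels. -/
def bscLaw (q d e : ℝ) (t : Bool × Bool × Bool × Bool) : ℝ :=
  if t.2.2.2 = t.2.1 then bern q t.2.1 * bsc d t.2.1 t.1 * bsc e t.2.1 t.2.2.1 else 0

theorem achievable_bscLaw {q d e : ℝ} (hq0 : 0 < q) (hq1 : q ≤ 1 / 2) (he : 0 ≤ e) (hed : e < d)
    (hd : d < 1 / 2) :
    Achievable (bern (q + d - 2 * q * d)) (bsc e) EncoderClass.noncausal (bscLaw q d e) := by
  refine achievable_noncausal_of_lt (PX := bern q) (V := bsc d)
    (PY := bern (q + e - 2 * q * e))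
    (isPMF_bern hq0.le (by linarith)) (isPMF_bsc (by linarith) (by linarith))
    (isPMF_bsc he (by linarith)) (bern_eq_sum_bsc q d) (bern_pos (by nlinarith) (by nlinarith))
    (bern_eq_sum_bsc q e) (bern_pos (by nlinarith) (by nlinarith)) ?_ fun _ _ _ _ => rfl
  rw [sum_bern_bsc_log, sum_bern_bsc_log]
  exact binEntropy_sub_lt hq0 hq1 he hed hd

theorem add_sub_two_mul_eq {p d : ℝ} (hd : d < 1 / 2) :
    (p - d) / (1 - 2 * d) + d - 2 * ((p - d) / (1 - 2 * d)) * d = p := by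
  have h := div_mul_cancel₀ (p - d) (show 1 - 2 * d ≠ 0 by linarith)
  linear_combination h

theorem continuousAt_tvDist_bscLaw (p e : ℝ) {d : ℝ} (hd : d < 1 / 2)
    (P : Bool × Bool × Bool × Bool → ℝ) :
    ContinuousAt (fun d' => tvDist (bscLaw ((p - d') / (1 - 2 * d')) d' e) P) d := by
  have h : 1 - 2 * d ≠ 0 := by linarith
  have hq : ContinuousAt (fun d' : ℝ => (p - d') / (1 - 2 * d')) d := by
    fun_prop (disch := assumption)
  have hb : ∀ x, ContinuousAt (fun d' : ℝ => bern ((p - d') / (1 - 2 * d')) x) d := by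
    intro x
    unfold bern
    split_ifs
    exacts [hq, continuousAt_const.sub hq]
  have hs : ∀ x s, ContinuousAt (fun d' : ℝ => bsc d' x s) d := by
    intro x s
    unfold bsc
    split_ifs <;> fun_prop
  have hl : ∀ t, ContinuousAt (fun d' : ℝ => bscLaw ((p - d') / (1 - 2 * d')) d' e t) d := by
    intro t
    unfold bscLaw
    split_ifs
    · exact ((hb _).mul (hs _ _)).mul continuousAt_const
    · exact continuousAt_const
  unfold tvDist
  fun_prop

theorem achievable_bscLaw_of_le {p d e : ℝ} (he0 : 0 ≤ e) (hed : e ≤ d) (hdp : d ≤ p)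
    (hp : p ≤ 1 / 2) (hd : d < 1 / 2) :
    Achievable (bern p) (bsc e) EncoderClass.noncausal
      (bscLaw ((p - d) / (1 - 2 * d)) d e) := by
  have hPS := isPMF_bern (q := p) (by linarith) (by linarith)
  have hW := isPMF_bsc he0 (show e ≤ 1 by linarith)
  rcases hdp.eq_or_lt with rfl | hdp
  · refine achievable_const hPS hW false false ?_
    rintro ⟨s, x, y, z⟩
    simp only [margProb, prob, Fintype.sum_prod_type, Fintype.sum_bool, Set.indicator_apply,
      Set.mem_ofPred_eq, bscLaw]
    cases s <;> cases x <;> cases y <;> cases z <;> simp [bern, bsc]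
  · refine achievable_of_forall_tvDist_lt hPS.1 (fun x => (hW x).1) fun δ hδ => ?_
    have hcont := continuousAt_tvDist_bscLaw p e hd (bscLaw ((p - d) / (1 - 2 * d)) d e)
    have h0 : tvDist (bscLaw ((p - d) / (1 - 2 * d)) d e)
        (bscLaw ((p - d) / (1 - 2 * d)) d e) < δ := by simpa [tvDist] using hδ
    have hlt := (hcont.eventually_lt continuousAt_const h0).filter_mono
      (nhdsWithin_le_nhds (s := Set.Ioi d))
    obtain ⟨d', hd', hdd', hdp'⟩ := (hlt.and (Ioo_mem_nhdsGT hdp)).exists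
    refine ⟨_, hd', ?_⟩
    have hden : 0 < 1 - 2 * d' := by linarith
    set q := (p - d') / (1 - 2 * d') with hq
    have hq0 : 0 < q := div_pos (by linarith) hden
    have hq1 : q ≤ 1 / 2 := by
      rw [hq, div_le_iff₀ hden]
      linarith
    have hd'2 : d' < 1 / 2 := by linarith
    simpa only [hq, add_sub_two_mul_eq hd'2] using
      achievable_bscLaw hq0 hq1 he0 (hed.trans_lt hdd') hd'2

/-- **Binary example.** Source `Bern(p)` on `{0,1}`, channel `BSC(e)`. If
`0 ≤ e ≤ d ≤ p ≤ 1/2` and `d < 1/2`, let `q = (p−d)/(1−2d)` and let `P` be the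
joint law of `(S,X,Y,Ŝ)` with `X ∼ Bern(q)`, `S = X ⊕ Z₁` (`Z₁ ∼ Bern(d)`
independent of `X`), `Y = X ⊕ Z₂` (`Z₂ ∼ Bern(e)` independent of `(X,Z₁)`) and
`Ŝ = X`. Then `P` is consistent with the source and the channel, satisfies
`ℙ[S ≠ Ŝ] = ℙ[S ≠ X] = d`, and is achievable with a noncausal encoder. -/
theorem binary_example
    (p d e q : ℝ)
    (he0 : 0 ≤ e) (hed : e ≤ d) (hdp : d ≤ p) (hp : p ≤ 1 / 2) (hd : d < 1 / 2)
    (hq : q = (p - d) / (1 - 2 * d))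
    (PS : Bool → ℝ) (hPS : ∀ s, PS s = if s then p else 1 - p)
    (PYX : Bool → Bool → ℝ) (hPYX : ∀ x y, PYX x y = if y = x then 1 - e else e)
    (P : Bool × Bool × Bool × Bool → ℝ)
    (hPdef : ∀ s x y z, P (s, x, y, z) =
      (if x then q else 1 - q) * (if s = x then 1 - d else d) *
        (if y = x then 1 - e else e) * (if z = x then 1 else 0)) :
    (∀ s, (∑ x, ∑ y, ∑ z, P (s, x, y, z)) = PS s) ∧
    (∀ s x y, (∑ z, P (s, x, y, z)) = (∑ y', ∑ z, P (s, x, y', z)) * PYX x y) ∧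
    (∑ t : Bool × Bool × Bool × Bool, if t.1 ≠ t.2.2.2 then P t else 0) = d ∧
    (∑ t : Bool × Bool × Bool × Bool, if t.1 ≠ t.2.1 then P t else 0) = d ∧
    Achievable PS PYX EncoderClass.noncausal P := by
  have hPS' : PS = bern p := funext hPS
  have hPYX' : PYX = bsc e := funext fun x => funext fun y => hPYX x y
  have hpq : q + d - 2 * q * d = p := hq ▸ add_sub_two_mul_eq hd
  have hP' : P = bscLaw q d e := by
    funext ⟨s, x, y, z⟩
    rw [hPdef]
    by_cases hz : z = x <;> simp [bscLaw, bern, bsc, hz]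
  refine ⟨?_, ?_, ?_, ?_, ?_⟩
  · intro s
    cases s <;> simp [hPdef, hPS]
    · linear_combination -hpq
    · linear_combination hpq
  · intro s x y
    cases s <;> cases x <;> cases y <;> simp [hPdef, hPYX, -mul_eq_mul_right_iff] <;> ring
  · simp [Fintype.sum_prod_type, hPdef]
    ring
  · simp [Fintype.sum_prod_type, hPdef]
    ring
  · rw [hPS', hPYX', hP', hq]
    exact achievable_bscLaw_of_le he0 hed hdp hp hd

end
end

section
/- Converse key inequality for strictly causal encoding: let S_1,…,S_n be i.i.d. with pmf P_S on a finite set 𝒮, let X_i = f_i(S^{i−1}) for functions f_i : 𝒮^{i−1} → 𝒳, let the channel be memoryless so that given Xⁿ the outputs Y_1,…,Y_n are conditionally independent with Y_i ∼ P_{Y|X}(·|X_i). Let Q be uniform on {1,…,n} and independent of (Sⁿ, Xⁿ, Yⁿ), and define V = (S^{Q−1}, Y_{Q+1}ⁿ, Q). Then I(X_Q, V; S_Q) ≤ I(X_Q, V; Y_Q). -/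
noncomputable section

/-- Entropy of `f` in nats, written as the expected self-information. -/
def entropy {Ω A : Type*} [Fintype Ω] (P : Ω → ℝ) (f : Ω → A) : ℝ :=
  -∑ ω, P ω * Real.log (margProb P f (f ω))

section FiniteEntropy

variable {Ω A B : Type*} [Fintype Ω] {P : Ω → ℝ}

open Classical in
lemma margProb_eq_sum (P : Ω → ℝ) (f : Ω → A) (a : A) :
    margProb P f a = ∑ ω, if f ω = a then P ω else 0 := by
  simp [margProb, prob, Set.indicator_apply]

lemma margProb_congr {f : Ω → A} {g : Ω → B} {a : A} {b : B}
    (h : ∀ ω, f ω = a ↔ g ω = b) : margProb P f a = margProb P g b := by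
  simp [margProb, h]

lemma entropy_congr {f : Ω → A} {g : Ω → B}
    (h : ∀ ω ω', f ω' = f ω ↔ g ω' = g ω) : entropy P f = entropy P g := by
  simp [entropy, fun ω => margProb_congr (P := P) (h ω)]

lemma margProb_nonneg (hP : ∀ ω, 0 ≤ P ω) (f : Ω → A) (a : A) : 0 ≤ margProb P f a :=
  Finset.sum_nonneg fun _ _ => Set.indicator_nonneg (fun ω _ => hP ω) _

lemma margProb_pos (hP : ∀ ω, 0 ≤ P ω) (f : Ω → A) {ω : Ω} (hω : 0 < P ω) {a : A}
    (h : f ω = a) : 0 < margProb P f a := by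
  classical
  rw [margProb_eq_sum]
  refine Finset.sum_pos' (fun i _ => ?_) ⟨ω, Finset.mem_univ _, by simpa [h] using hω⟩
  split_ifs
  exacts [hP i, le_rfl]

lemma sum_margProb_mul [Fintype A] (f : Ω → A) (φ : A → ℝ) :
    ∑ a, margProb P f a * φ a = ∑ ω, P ω * φ (f ω) := by
  classical
  simp_rw [margProb_eq_sum, Finset.sum_mul]
  rw [Finset.sum_comm]
  simp [ite_mul]

lemma sum_margProb [Fintype A] (f : Ω → A) : ∑ a, margProb P f a = ∑ ω, P ω := by
  simpa using sum_margProb_mul (P := P) f fun _ => 1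

lemma mutInfo_eq_entropy [Fintype A] [Fintype B] (hP : ∀ ω, 0 ≤ P ω)
    (f : Ω → A) (g : Ω → B) :
    mutInfo P f g =
      (entropy P f + entropy P g - entropy P (fun ω => (f ω, g ω))) / Real.log 2 := by
  have h := sum_margProb_mul (P := P) (fun ω => (f ω, g ω)) fun c =>
    Real.logb 2 (margProb P (fun ω => (f ω, g ω)) c / (margProb P f c.1 * margProb P g c.2))
  rw [Fintype.sum_prod_type] at h
  rw [mutInfo, h, eq_div_iff (Real.log_pos one_lt_two).ne', entropy, entropy, entropy,
    Finset.sum_mul, ← Finset.sum_neg_distrib, ← Finset.sum_neg_distrib,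
    ← Finset.sum_neg_distrib, ← Finset.sum_add_distrib, ← Finset.sum_sub_distrib]
  refine Finset.sum_congr rfl fun ω _ => ?_
  rcases (hP ω).eq_or_lt with h0 | h0
  · simp [← h0]
  have hf := margProb_pos hP f h0 rfl
  have hg := margProb_pos hP g h0 rfl
  have hfg := margProb_pos hP (fun ω => (f ω, g ω)) h0 rfl
  have hl := (Real.log_pos one_lt_two).ne'
  rw [Real.logb, mul_assoc, div_mul_cancel₀ _ hl, Real.log_div hfg.ne' (mul_pos hf hg).ne',
    Real.log_mul hf.ne' hg.ne']
  ring

/-- Gibbs' inequality: entropy is at most the cross-entropy relative to any pmf `ν`. -/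
lemma entropy_le_cross_entropy [Fintype A] (hP : IsPMF P) (f : Ω → A) {ν : A → ℝ}
    (hν : IsPMF ν) (hpos : ∀ ω, 0 < P ω → 0 < ν (f ω)) :
    entropy P f ≤ -∑ ω, P ω * Real.log (ν (f ω)) := by
  have key : ∑ a, margProb P f a * (Real.log (ν a) - Real.log (margProb P f a)) ≤
      ∑ a, (ν a - margProb P f a) := by
    refine Finset.sum_le_sum fun a _ => ?_
    rcases (margProb_nonneg hP.1 f a).eq_or_lt with h0 | h0
    · simpa [← h0] using hν.1 a
    have hνa : 0 < ν a := by
      by_contra hle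
      have hz : margProb P f a = 0 := by
        classical
        rw [margProb_eq_sum]
        refine Finset.sum_eq_zero fun ω _ => ?_
        split_ifs with h
        · by_contra hne
          exact hle (h ▸ hpos ω ((hP.1 ω).lt_of_ne' hne))
        · rfl
      exact h0.ne' hz
    have := Real.log_le_sub_one_of_pos (div_pos hνa h0)
    rw [Real.log_div hνa.ne' h0.ne'] at this
    calc _ ≤ margProb P f a * (ν a / margProb P f a - 1) := by gcongr
      _ = ν a - margProb P f a := by field_simp
  rw [Finset.sum_sub_distrib, sum_margProb, hν.2, hP.2, sub_self, sum_margProb_mul] at key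
  simp only [mul_sub, Finset.sum_sub_distrib] at key
  rw [entropy]
  linarith

end FiniteEntropy

lemma IsPMF.pi {ι α : Type*} [Fintype ι] [DecidableEq ι] [Fintype α] {μ : ι → α → ℝ}
    (hμ : ∀ i, IsPMF (μ i)) : IsPMF fun a : ι → α => ∏ i, μ i (a i) := by
  refine ⟨fun a => Finset.prod_nonneg fun i _ => (hμ i).1 _, ?_⟩
  rw [← Fintype.piFinset_univ, ← Finset.prod_univ_sum]
  simp [(hμ _).2]

section TimeSharing

variable {Z A B : Type*} [Fintype Z] {n : ℕ} {P : Fin n × Z → ℝ} {R : Z → ℝ}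

lemma IsPMF.timeSharing (hn : 0 < n) (hP : ∀ q z, P (q, z) = (1 / (n : ℝ)) * R z)
    (hR : IsPMF R) : IsPMF P := by
  refine ⟨fun ⟨q, z⟩ => ?_, ?_⟩
  · rw [hP]
    exact mul_nonneg (by positivity) (hR.1 z)
  · have : (n : ℝ) ≠ 0 := by positivity
    simp [Fintype.sum_prod_type, hP, ← Finset.mul_sum, hR.2, this]

/-- Conditioning on the time-sharing variable when it is determined by `F`. -/
lemma entropy_timeSharing (hn : 0 < n) (hP : ∀ q z, P (q, z) = (1 / (n : ℝ)) * R z)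
    (hR : IsPMF R) (F : Fin n × Z → A) (G : Fin n → Z → B)
    (h : ∀ q z q' z', F (q', z') = F (q, z) ↔ q' = q ∧ G q z' = G q z) :
    entropy P F = Real.log n + (1 / (n : ℝ)) * ∑ q, entropy R (G q) := by
  have hn' : (0 : ℝ) < n := by positivity
  have hm : ∀ q z, margProb P F (F (q, z)) = (1 / (n : ℝ)) * margProb R (G q) (G q z) := by
    classical
    intro q z
    rw [margProb_eq_sum, margProb_eq_sum, Fintype.sum_prod_type, Finset.mul_sum]
    simp_rw [h, hP]
    rw [Finset.sum_eq_single q (by intro b _ hb; simp [hb]) (by simp)]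
    simp
  have hl : ∀ q z, P (q, z) * Real.log (margProb P F (F (q, z))) =
      (1 / (n : ℝ)) * (R z * Real.log (margProb R (G q) (G q z)) - R z * Real.log n) := by
    intro q z
    rw [hm, hP]
    rcases (hR.1 z).eq_or_lt with h0 | h0
    · simp [← h0]
    have := margProb_pos hR.1 (G q) h0 rfl
    rw [Real.log_mul (by positivity) this.ne', one_div, Real.log_inv]
    ring
  simp only [entropy, Fintype.sum_prod_type, hl, ← Finset.mul_sum, Finset.sum_sub_distrib,
    ← Finset.sum_mul, hR.2, Finset.sum_neg_distrib]
  simp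
  field_simp
  ring

lemma sum_timeSharing_mul_log (hP : ∀ q z, P (q, z) = (1 / (n : ℝ)) * R z)
    (hR : IsPMF R) (g : Z → Fin n → A) (ν : A → ℝ)
    (hpos : ∀ z q, 0 < R z → 0 < ν (g z q)) :
    ∑ ω : Fin n × Z, P ω * Real.log (ν (g ω.2 ω.1)) =
      (1 / (n : ℝ)) * ∑ z, R z * Real.log (∏ q, ν (g z q)) := by
  rw [Fintype.sum_prod_type, Finset.sum_comm, Finset.mul_sum]
  refine Finset.sum_congr rfl fun z _ => ?_
  simp_rw [hP, mul_assoc, ← Finset.mul_sum]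
  rcases (hR.1 z).eq_or_lt with h0 | h0
  · simp [← h0]
  rw [Real.log_prod fun q _ => (hpos z q h0).ne']

end TimeSharing

/-- The sequence whose entries are those of `z.1` before time `k` and of `z.2` from then on. -/
def splice {S Y : Type*} {n : ℕ} (k : ℕ) (z : (Fin n → S) × (Fin n → Y)) : Fin n → S ⊕ Y :=
  fun j => if (j : ℕ) < k then Sum.inl (z.1 j) else Sum.inr (z.2 j)

lemma splice_eq_iff {S Y : Type*} {n : ℕ} (k : ℕ) (z z' : (Fin n → S) × (Fin n → Y)) :
    splice k z' = splice k z ↔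
      (∀ j : Fin n, (j : ℕ) < k → z'.1 j = z.1 j) ∧
        ∀ j : Fin n, k ≤ (j : ℕ) → z'.2 j = z.2 j := by
  simp only [splice, funext_iff]
  constructor
  · intro h
    refine ⟨fun j hj => ?_, fun j hj => ?_⟩
    · simpa [hj] using h j
    · simpa [hj.not_gt] using h j
  · rintro ⟨h₁, h₂⟩ j
    split_ifs with hj
    · rw [h₁ j hj]
    · rw [h₂ j (not_lt.1 hj)]

/-- **Converse key inequality for strictly causal encoding.**
`S₁,…,Sₙ` i.i.d. `P_S`; `Xᵢ = fᵢ(Sⁱ⁻¹)`; the channel is memoryless with law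
`P_{Y|X}`; `Q` is uniform on `{1,…,n}` and independent of `(Sⁿ,Xⁿ,Yⁿ)`
(so the joint pmf of `(Q,Sⁿ,Yⁿ)` is `P(q,sⁿ,yⁿ) = (1/n)·∏ᵢP_S(sᵢ)·∏ᵢP_{Y|X}(yᵢ|xᵢ)`);
and `V = (S^{Q−1}, Y_{Q+1}ⁿ, Q)`.  Then `I(X_Q,V;S_Q) ≤ I(X_Q,V;Y_Q)`. -/
theorem strictly_causal_converse_key_inequality
    {S X Y : Type} [Fintype S] [Fintype X] [Fintype Y]
    (PS : S → ℝ) (PYX : X → Y → ℝ)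
    (hPS : IsPMF PS) (hPYX : ∀ x, IsPMF (PYX x))
    (n : ℕ) (hn : 0 < n)
    (f : (i : Fin n) → ({j : Fin n // j < i} → S) → X)
    (P : Fin n × (Fin n → S) × (Fin n → Y) → ℝ)
    (hP : ∀ (q : Fin n) (s : Fin n → S) (y : Fin n → Y),
      P (q, s, y) = (1 / (n : ℝ)) * (∏ i, PS (s i)) *
        ∏ i, PYX (f i (fun j => s j.1)) (y i))
    (XQ : Fin n × (Fin n → S) × (Fin n → Y) → X)
    (hXQ : ∀ ω, XQ ω = f ω.1 (fun j => ω.2.1 j.1))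
    (V : Fin n × (Fin n → S) × (Fin n → Y) →
      (q : Fin n) × (({j : Fin n // j < q} → S) × ({j : Fin n // q < j} → Y)))
    (hV : ∀ ω, V ω = ⟨ω.1, fun j => ω.2.1 j.1, fun j => ω.2.2 j.1⟩) :
    mutInfo P (fun ω => (XQ ω, V ω)) (fun ω => ω.2.1 ω.1)
      ≤ mutInfo P (fun ω => (XQ ω, V ω)) (fun ω => ω.2.2 ω.1) := by
  classical
  set R : (Fin n → S) × (Fin n → Y) → ℝ := fun z =>
    (∏ i, PS (z.1 i)) * ∏ i, PYX (f i (fun j => z.1 j.1)) (z.2 i) with hRdef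
  have hPR : ∀ q z, P (q, z) = (1 / (n : ℝ)) * R z := fun q z => by
    rw [hP, mul_assoc]
  have hn' : (0 : ℝ) < n := by positivity
  have hch : ∀ s : Fin n → S,
      IsPMF fun y : Fin n → Y => ∏ i, PYX (f i (fun j => s j.1)) (y i) :=
    fun s => IsPMF.pi fun i => hPYX _
  have hsrc : IsPMF fun s : Fin n → S => ∏ i, PS (s i) := IsPMF.pi fun _ => hPS
  have hR : IsPMF R := by
    refine ⟨fun z => mul_nonneg (hsrc.1 _) ((hch z.1).1 _), ?_⟩
    simp only [hRdef, Fintype.sum_prod_type, ← Finset.mul_sum, (hch _).2, mul_one]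
    exact hsrc.2
  have hPpmf : IsPMF P := IsPMF.timeSharing hn hPR hR
  have hPSpos : ∀ z q, 0 < R z → 0 < PS (z.1 q) := by
    intro z q hz
    refine (hPS.1 _).lt_of_ne' fun h0 => hz.ne' ?_
    simp [hRdef, Finset.prod_eq_zero (f := fun i => PS (z.1 i)) (Finset.mem_univ q) h0]
  set T : ℕ → ℝ := fun k => entropy R (splice k) with hT
  have hVS : entropy P (fun ω => ((XQ ω, V ω), ω.2.1 ω.1)) =
      Real.log n + (1 / (n : ℝ)) * ∑ q : Fin n, T (q + 1) := by
    refine entropy_timeSharing hn hPR hR _ (fun q => splice (q + 1)) fun q z q' z' => ?_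
    simp only [splice_eq_iff, hXQ, hV, Prod.mk.injEq]
    constructor
    · rintro ⟨⟨-, h⟩, hs⟩
      obtain rfl : q' = q := congrArg Sigma.fst h
      simp only [Sigma.mk.injEq, heq_eq_eq, true_and, Prod.mk.injEq, funext_iff,
        Subtype.forall] at h
      refine ⟨rfl, fun j hj => ?_, fun j hj => h.2 j (Fin.lt_def.2 (by omega))⟩
      rcases eq_or_ne j q' with rfl | hne
      · exact hs
      · exact h.1 j (Fin.lt_def.2 (by have := Fin.val_ne_of_ne hne; omega))
    · rintro ⟨rfl, h₁, h₂⟩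
      have e₁ : (fun j : {j : Fin n // j < q'} => z'.1 j.1) = fun j => z.1 j.1 :=
        funext fun j => h₁ j.1 (by have := Fin.lt_def.1 j.2; omega)
      have e₂ : (fun j : {j : Fin n // q' < j} => z'.2 j.1) = fun j => z.2 j.1 :=
        funext fun j => h₂ j.1 (by have := Fin.lt_def.1 j.2; omega)
      exact ⟨⟨by rw [e₁], by rw [e₁, e₂]⟩, h₁ q' (by omega)⟩
  have hVY : entropy P (fun ω => ((XQ ω, V ω), ω.2.2 ω.1)) =
      Real.log n + (1 / (n : ℝ)) * ∑ q : Fin n, T q := by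
    refine entropy_timeSharing hn hPR hR _ (fun q => splice q) fun q z q' z' => ?_
    simp only [splice_eq_iff, hXQ, hV, Prod.mk.injEq]
    constructor
    · rintro ⟨⟨-, h⟩, hs⟩
      obtain rfl : q' = q := congrArg Sigma.fst h
      simp only [Sigma.mk.injEq, heq_eq_eq, true_and, Prod.mk.injEq, funext_iff,
        Subtype.forall] at h
      refine ⟨rfl, fun j hj => h.1 j (Fin.lt_def.2 hj), fun j hj => ?_⟩
      rcases eq_or_ne j q' with rfl | hne
      · exact hs
      · exact h.2 j (Fin.lt_def.2 (by have := Fin.val_ne_of_ne hne; omega))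
    · rintro ⟨rfl, h₁, h₂⟩
      have e₁ : (fun j : {j : Fin n // j < q'} => z'.1 j.1) = fun j => z.1 j.1 :=
        funext fun j => h₁ j.1 (Fin.lt_def.1 j.2)
      have e₂ : (fun j : {j : Fin n // q' < j} => z'.2 j.1) = fun j => z.2 j.1 :=
        funext fun j => h₂ j.1 (Fin.lt_def.1 j.2).le
      exact ⟨⟨by rw [e₁], by rw [e₁, e₂]⟩, h₂ q' le_rfl⟩
  have htel : ∑ q : Fin n, T (q + 1) - ∑ q : Fin n, T q = T n - T 0 := by
    rw [← Finset.sum_sub_distrib, Fin.sum_univ_eq_sum_range (fun k => T (k + 1) - T k),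
      Finset.sum_range_sub]
  have hS : entropy P (fun ω => ω.2.1 ω.1) ≤ (1 / (n : ℝ)) * T n := by
    have hTn : T n = -∑ z, R z * Real.log (∏ q, PS (z.1 q)) := by
      have h : T n = entropy R Prod.fst :=
        entropy_congr fun z z' => by
          rw [splice_eq_iff]
          exact ⟨fun h => funext fun j => h.1 j j.2,
            fun h => ⟨fun j _ => congrFun h j, fun j hj => absurd j.2 hj.not_gt⟩⟩
      rw [h, entropy]
      congr 1
      refine Finset.sum_congr rfl fun z _ => ?_
      congr 2
      rw [margProb_eq_sum, Fintype.sum_prod_type, Finset.sum_eq_single z.1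
        (by intro s _ hs; simp [hs]) (by simp)]
      simp only [hRdef, if_true, ← Finset.mul_sum, (hch _).2, mul_one]
    have hpos : ∀ ω : Fin n × (Fin n → S) × (Fin n → Y), 0 < P ω → 0 < PS (ω.2.1 ω.1) := by
      rintro ⟨q, z⟩ h
      rw [hPR] at h
      exact hPSpos z q (pos_of_mul_pos_right h (by positivity))
    have h := entropy_le_cross_entropy hPpmf (fun ω => ω.2.1 ω.1) hPS hpos
    rw [sum_timeSharing_mul_log hPR hR (fun z => z.1) PS hPSpos] at h
    rw [hTn]
    linarith
  have hY : (1 / (n : ℝ)) * T 0 ≤ entropy P (fun ω => ω.2.2 ω.1) := by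
    set μ : Y → ℝ := margProb P (fun ω => ω.2.2 ω.1) with hμdef
    have hμ : IsPMF μ := ⟨margProb_nonneg hPpmf.1 _, (sum_margProb _).trans hPpmf.2⟩
    have hμpos : ∀ z q, 0 < R z → 0 < μ (z.2 q) := fun z q hz =>
      margProb_pos hPpmf.1 (fun ω => ω.2.2 ω.1) (ω := (q, z))
        (by rw [hPR]; positivity) rfl
    have h0 : T 0 = entropy R Prod.snd :=
      entropy_congr fun z z' => by
        rw [splice_eq_iff]
        exact ⟨fun h => funext fun j => h.2 j j.val.zero_le,
          fun h => ⟨fun j hj => absurd hj j.val.not_lt_zero, fun j _ => congrFun h j⟩⟩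
    have h := entropy_le_cross_entropy hR Prod.snd (IsPMF.pi fun _ : Fin n => hμ)
      fun z hz => Finset.prod_pos fun q _ => hμpos z q hz
    rw [entropy, sum_timeSharing_mul_log hPR hR (fun z => z.2) μ hμpos, h0, ← mul_neg]
    gcongr
  rw [mutInfo_eq_entropy hPpmf.1, mutInfo_eq_entropy hPpmf.1, hVS, hVY]
  have hdiff := congrArg (fun t => (1 / (n : ℝ)) * t) htel
  simp only [mul_sub] at hdiff
  exact div_le_div_of_nonneg_right (by linarith) (Real.log_pos one_lt_two).le

end
end
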